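/- arXiv:2405.14032 — 5 statements merged into one kernel-verified Lean document; each statement's English description precedes it below -/
import Mathlib

section
/- If the matrix W + δw • 1 + Σx is positive definite, then the condensed KKT matrix M_cond := W + δw • 1 + Σx + Aᵀ * D * A is positive definite (in particular invertible, so the condensed KKT system M_cond Δx = r has a unique solution for every right-hand side r, and Cholesky factorization without numerical pivoting applies). -/
open Matrix

/-- `C := (δc • Σs + (1 + δc*δw) • 1)⁻¹` from the condensed-space IPM. -/
noncomputable def Cmat (m : ℕ) (δw δc : ℝ) (σs : Fin m → ℝ) : Matrix (Fin m) (Fin m) ℝ :=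
  (δc • Matrix.diagonal σs + (1 + δc * δw) • (1 : Matrix (Fin m) (Fin m) ℝ))⁻¹

/-- `D := (Σs + δw • 1) * C`. -/
noncomputable def Dmat (m : ℕ) (δw δc : ℝ) (σs : Fin m → ℝ) : Matrix (Fin m) (Fin m) ℝ :=
  (Matrix.diagonal σs + δw • (1 : Matrix (Fin m) (Fin m) ℝ)) * Cmat m δw δc σs

/-- The condensed KKT matrix `M_cond := W + δw • 1 + Σx + Aᵀ * D * A`. -/
noncomputable def Mcond (n m : ℕ) (W : Matrix (Fin n) (Fin n) ℝ)
    (A : Matrix (Fin m) (Fin n) ℝ) (δw δc : ℝ) (σx : Fin n → ℝ) (σs : Fin m → ℝ) :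
    Matrix (Fin n) (Fin n) ℝ :=
  W + δw • (1 : Matrix (Fin n) (Fin n) ℝ) + Matrix.diagonal σx + Aᵀ * Dmat m δw δc σs * A

theorem Cmat_eq_diagonal {m : ℕ} {δw δc : ℝ} {σs : Fin m → ℝ} (hδw : 0 ≤ δw) (hδc : 0 ≤ δc)
    (hσs : ∀ j, 0 ≤ σs j) :
    Cmat m δw δc σs = diagonal fun j => (δc * σs j + (1 + δc * δw))⁻¹ := by
  have hdiag : δc • diagonal σs + (1 + δc * δw) • (1 : Matrix (Fin m) (Fin m) ℝ) =
      diagonal fun j => δc * σs j + (1 + δc * δw) := by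
    ext i j
    by_cases h : i = j <;> simp [h]
  have hne (j : Fin m) : δc * σs j + (1 + δc * δw) ≠ 0 := by
    have := hσs j
    positivity
  rw [Cmat, hdiag]
  apply Matrix.inv_eq_right_inv
  rw [diagonal_mul_diagonal, ← diagonal_one]
  congr 1
  funext j
  exact mul_inv_cancel₀ (hne j)

theorem Dmat_eq_diagonal {m : ℕ} {δw δc : ℝ} {σs : Fin m → ℝ} (hδw : 0 ≤ δw) (hδc : 0 ≤ δc)
    (hσs : ∀ j, 0 ≤ σs j) :
    Dmat m δw δc σs = diagonal fun j => (σs j + δw) * (δc * σs j + (1 + δc * δw))⁻¹ := by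
  rw [Dmat, Cmat_eq_diagonal hδw hδc hσs, smul_one_eq_diagonal, diagonal_add,
    diagonal_mul_diagonal]

theorem Dmat_posSemidef {m : ℕ} {δw δc : ℝ} {σs : Fin m → ℝ} (hδw : 0 ≤ δw) (hδc : 0 ≤ δc)
    (hσs : ∀ j, 0 ≤ σs j) : (Dmat m δw δc σs).PosSemidef := by
  rw [Dmat_eq_diagonal hδw hδc hσs]
  refine PosSemidef.diagonal fun j => ?_
  have := hσs j
  simp only [Pi.zero_apply]
  positivity

theorem stmt_3 (n m : ℕ) (W : Matrix (Fin n) (Fin n) ℝ) (hW : W.IsSymm)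
    (A : Matrix (Fin m) (Fin n) ℝ) (δw δc : ℝ) (hδw : 0 < δw) (hδc : 0 < δc)
    (σx : Fin n → ℝ) (hσx : ∀ i, 0 < σx i) (σs : Fin m → ℝ) (hσs : ∀ j, 0 < σs j)
    (hpos : (W + δw • (1 : Matrix (Fin n) (Fin n) ℝ) + Matrix.diagonal σx).PosDef) :
    (Mcond n m W A δw δc σx σs).PosDef ∧
    IsUnit (Mcond n m W A δw δc σx σs) ∧
    ∀ r : Fin n → ℝ, ∃! Δx : Fin n → ℝ, (Mcond n m W A δw δc σx σs).mulVec Δx = r := by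
  have hM : (Mcond n m W A δw δc σx σs).PosDef := by
    have hD := Dmat_posSemidef hδw.le hδc.le fun j => (hσs j).le
    have hA := hD.conjTranspose_mul_mul_same A
    rw [conjTranspose_eq_transpose_of_trivial] at hA
    exact hpos.add_posSemidef hA
  refine ⟨hM, hM.isUnit, fun r => ?_⟩
  exact Function.Bijective.existsUnique ⟨mulVec_injective_iff_isUnit.2 hM.isUnit,
    mulVec_surjective_iff_isUnit.2 hM.isUnit⟩ r
end

section
/- Suppose Δx : Fin n → ℝ satisfies the condensed KKT system M_cond.mulVec Δx = qx + Aᵀ.mulVec (C.mulVec qs + D.mulVec qy), and define Δs := C.mulVec (δc • qs + A.mulVec Δx - qy) and Δy := (Σs + δw • 1).mulVec Δs - qs. Then (Δx, Δs, Δy) satisfies the reduced KKT system: (W + δw • 1 + Σx).mulVec Δx + Aᵀ.mulVec Δy = qx, (Σs + δw • 1).mulVec Δs - Δy = qs, and A.mulVec Δx - Δs - δc • Δy = qy. -/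
open Matrix

/-- Since `Cmat` inverts `δc • (Σs + δw • 1) + 1`, it satisfies `δc • D + C = 1`. -/
theorem smul_Dmat_add_Cmat (m : ℕ) {δw δc : ℝ} (hδw : 0 < δw) (hδc : 0 < δc)
    {σs : Fin m → ℝ} (hσs : ∀ j, 0 < σs j) :
    δc • Dmat m δw δc σs + Cmat m δw δc σs = 1 := by
  have hdiag : δc • Matrix.diagonal σs + (1 + δc * δw) • (1 : Matrix (Fin m) (Fin m) ℝ)
      = Matrix.diagonal (fun j => δc * σs j + (1 + δc * δw)) := by
    rw [Matrix.smul_one_eq_diagonal, ← Matrix.diagonal_smul, Matrix.diagonal_add]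
    rfl
  have hunit : IsUnit
      (δc • Matrix.diagonal σs + (1 + δc * δw) • (1 : Matrix (Fin m) (Fin m) ℝ)).det := by
    rw [hdiag, Matrix.det_diagonal, isUnit_iff_ne_zero]
    refine Finset.prod_ne_zero_iff.mpr fun j _ => ?_
    have := hσs j
    positivity
  calc δc • Dmat m δw δc σs + Cmat m δw δc σs
      = (δc • Matrix.diagonal σs + (1 + δc * δw) • (1 : Matrix (Fin m) (Fin m) ℝ))
          * Cmat m δw δc σs := by
        simp only [Dmat, add_mul, smul_add, smul_smul, add_smul, one_smul, one_mul, smul_mul_assoc]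
        abel
    _ = 1 := Matrix.mul_nonsing_inv _ hunit

theorem stmt_5 (n m : ℕ) (W : Matrix (Fin n) (Fin n) ℝ) (hW : W.IsSymm)
    (A : Matrix (Fin m) (Fin n) ℝ) (δw δc : ℝ) (hδw : 0 < δw) (hδc : 0 < δc)
    (σx : Fin n → ℝ) (hσx : ∀ i, 0 < σx i) (σs : Fin m → ℝ) (hσs : ∀ j, 0 < σs j)
    (qx : Fin n → ℝ) (qs qy : Fin m → ℝ)
    (Δx : Fin n → ℝ) (Δs Δy : Fin m → ℝ)
    (hΔx : (Mcond n m W A δw δc σx σs).mulVec Δx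
            = qx + Aᵀ.mulVec ((Cmat m δw δc σs).mulVec qs + (Dmat m δw δc σs).mulVec qy))
    (hΔs : Δs = (Cmat m δw δc σs).mulVec (δc • qs + A.mulVec Δx - qy))
    (hΔy : Δy = (Matrix.diagonal σs + δw • (1 : Matrix (Fin m) (Fin m) ℝ)).mulVec Δs - qs) :
    (W + δw • (1 : Matrix (Fin n) (Fin n) ℝ) + Matrix.diagonal σx).mulVec Δx
        + Aᵀ.mulVec Δy = qx ∧
    (Matrix.diagonal σs + δw • (1 : Matrix (Fin m) (Fin m) ℝ)).mulVec Δs - Δy = qs ∧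
    A.mulVec Δx - Δs - δc • Δy = qy := by
  set C := Cmat m δw δc σs
  set D := Dmat m δw δc σs
  set S := Matrix.diagonal σs + δw • (1 : Matrix (Fin m) (Fin m) ℝ)
  have hDC : D = S * C := rfl
  have hsplit (v : Fin m → ℝ) : δc • D *ᵥ v + C *ᵥ v = v := by
    rw [← Matrix.smul_mulVec, ← Matrix.add_mulVec, smul_Dmat_add_Cmat m hδw hδc hσs,
      Matrix.one_mulVec]
  have hSs : S *ᵥ Δs = D *ᵥ (δc • qs + A *ᵥ Δx - qy) := by
    rw [hΔs, Matrix.mulVec_mulVec, hDC]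
  have hy : Δy = D *ᵥ (A *ᵥ Δx) - (C *ᵥ qs + D *ᵥ qy) := by
    rw [hΔy, hSs, Matrix.mulVec_sub, Matrix.mulVec_add, Matrix.mulVec_smul]
    linear_combination hsplit qs
  refine ⟨?_, ?_, ?_⟩
  · rw [Mcond, Matrix.add_mulVec, ← Matrix.mulVec_mulVec, ← Matrix.mulVec_mulVec] at hΔx
    rw [hy, Matrix.mulVec_sub]
    linear_combination hΔx
  · rw [hΔy, sub_sub_cancel]
  · have h := hsplit (δc • qs + A *ᵥ Δx - qy)
    rw [← hSs, ← hΔs] at h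
    rw [hΔy, smul_sub]
    linear_combination -h
end

section
/- Suppose the vectors Δx, Δzxl, Δzxu : Fin n → ℝ and Δs, Δy, Δzsl, Δzsu : Fin m → ℝ satisfy the full lifted KKT system: (1) (W + δw • 1).mulVec Δx + Aᵀ.mulVec Δy - Δzxl + Δzxu = px; (2) δw • Δs - Δy - Δzsl + Δzsu = ps; (3) A.mulVec Δx - Δs - δc • Δy = py; (4) (Matrix.diagonal zxl).mulVec Δx + (Matrix.diagonal dxl).mulVec Δzxl = pzxl; (5) -(Matrix.diagonal zxu).mulVec Δx + (Matrix.diagonal dxu).mulVec Δzxu = pzxu; (6) (Matrix.diagonal zsl).mulVec Δs + (Matrix.diagonal dsl).mulVec Δzsl = pzsl; (7) -(Matrix.diagonal zsu).mulVec Δs + (Matrix.diagonal dsu).mulVec Δzsu = pzsu. Then, with qx := px + (fun i => pzxl i / dxl i) - (fun i => pzxu i / dxu i), qs := ps + (fun j => pzsl j / dsl j) - (fun j => pzsu j / dsu j), and qy := py, the triple (Δx, Δs, Δy) satisfies the reduced KKT system (W + δw • 1 + Σx).mulVec Δx + Aᵀ.mulVec Δy = qx, (Σs + δw • 1).mulVec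 Δs - Δy = qs, A.mulVec Δx - Δs - δc • Δy = qy; and the bound multiplier steps satisfy Δzxl = fun i => (-(zxl i) * Δx i + pzxl i) / dxl i, Δzxu = fun i => (zxu i * Δx i + pzxu i) / dxu i, Δzsl = fun j => (-(zsl j) * Δs j + pzsl j) / dsl j, and Δzsu = fun j => (zsu j * Δs j + pzsu j) / dsu j. -/
open Matrix

/-- Solving the diagonal equation `z * u + d * v = p` for `v`. -/
theorem eq_div_of_diagonal_mulVec_add {ι : Type*} [Fintype ι] [DecidableEq ι]
    {d z u v p : ι → ℝ} (hd : ∀ i, d i ≠ 0)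
    (h : (Matrix.diagonal z).mulVec u + (Matrix.diagonal d).mulVec v = p) :
    v = fun i => (-(z i) * u i + p i) / d i := by
  funext i
  have hi := congrFun h i
  simp only [Pi.add_apply, mulVec_diagonal] at hi
  rw [eq_div_iff (hd i)]
  linarith

/-- Solving the diagonal equation `-z * u + d * v = p` for `v`. -/
theorem eq_div_of_neg_diagonal_mulVec_add {ι : Type*} [Fintype ι] [DecidableEq ι]
    {d z u v p : ι → ℝ} (hd : ∀ i, d i ≠ 0)
    (h : -(Matrix.diagonal z).mulVec u + (Matrix.diagonal d).mulVec v = p) :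
    v = fun i => (z i * u i + p i) / d i := by
  funext i
  have hi := congrFun h i
  simp only [Pi.add_apply, Pi.neg_apply, mulVec_diagonal] at hi
  rw [eq_div_iff (hd i)]
  linarith

theorem stmt_6 (n m : ℕ) (W : Matrix (Fin n) (Fin n) ℝ) (hW : W.IsSymm)
    (A : Matrix (Fin m) (Fin n) ℝ) (δw δc : ℝ) (hδw : 0 < δw) (hδc : 0 < δc)
    (dxl dxu zxl zxu : Fin n → ℝ)
    (hdxl : ∀ i, 0 < dxl i) (hdxu : ∀ i, 0 < dxu i)
    (hzxl : ∀ i, 0 < zxl i) (hzxu : ∀ i, 0 < zxu i)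
    (dsl dsu zsl zsu : Fin m → ℝ)
    (hdsl : ∀ j, 0 < dsl j) (hdsu : ∀ j, 0 < dsu j)
    (hzsl : ∀ j, 0 < zsl j) (hzsu : ∀ j, 0 < zsu j)
    (px pzxl pzxu : Fin n → ℝ) (ps py pzsl pzsu : Fin m → ℝ)
    (Δx Δzxl Δzxu : Fin n → ℝ) (Δs Δy Δzsl Δzsu : Fin m → ℝ)
    (h1 : (W + δw • (1 : Matrix (Fin n) (Fin n) ℝ)).mulVec Δx
            + Aᵀ.mulVec Δy - Δzxl + Δzxu = px)
    (h2 : δw • Δs - Δy - Δzsl + Δzsu = ps)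
    (h3 : A.mulVec Δx - Δs - δc • Δy = py)
    (h4 : (Matrix.diagonal zxl).mulVec Δx + (Matrix.diagonal dxl).mulVec Δzxl = pzxl)
    (h5 : -(Matrix.diagonal zxu).mulVec Δx + (Matrix.diagonal dxu).mulVec Δzxu = pzxu)
    (h6 : (Matrix.diagonal zsl).mulVec Δs + (Matrix.diagonal dsl).mulVec Δzsl = pzsl)
    (h7 : -(Matrix.diagonal zsu).mulVec Δs + (Matrix.diagonal dsu).mulVec Δzsu = pzsu) :
    (W + δw • (1 : Matrix (Fin n) (Fin n) ℝ)
        + Matrix.diagonal (fun i => zxl i / dxl i + zxu i / dxu i)).mulVec Δx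
        + Aᵀ.mulVec Δy
      = px + (fun i => pzxl i / dxl i) - (fun i => pzxu i / dxu i) ∧
    (Matrix.diagonal (fun j => zsl j / dsl j + zsu j / dsu j)
        + δw • (1 : Matrix (Fin m) (Fin m) ℝ)).mulVec Δs - Δy
      = ps + (fun j => pzsl j / dsl j) - (fun j => pzsu j / dsu j) ∧
    A.mulVec Δx - Δs - δc • Δy = py ∧
    Δzxl = (fun i => (-(zxl i) * Δx i + pzxl i) / dxl i) ∧
    Δzxu = (fun i => (zxu i * Δx i + pzxu i) / dxu i) ∧
    Δzsl = (fun j => (-(zsl j) * Δs j + pzsl j) / dsl j) ∧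
    Δzsu = (fun j => (zsu j * Δs j + pzsu j) / dsu j) := by
  have hzl := eq_div_of_diagonal_mulVec_add (fun i => (hdxl i).ne') h4
  have hzu := eq_div_of_neg_diagonal_mulVec_add (fun i => (hdxu i).ne') h5
  have hsl := eq_div_of_diagonal_mulVec_add (fun j => (hdsl j).ne') h6
  have hsu := eq_div_of_neg_diagonal_mulVec_add (fun j => (hdsu j).ne') h7
  refine ⟨?_, ?_, h3, hzl, hzu, hsl, hsu⟩
  · funext i
    have hi := congrFun h1 i
    have hl := congrFun hzl i
    have hu := congrFun hzu i
    rw [add_mulVec _ (Matrix.diagonal _)]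
    simp only [Pi.add_apply, Pi.sub_apply, mulVec_diagonal] at hi ⊢
    rw [← hi, hl, hu]
    ring
  · funext j
    have hj := congrFun h2 j
    have hl := congrFun hsl j
    have hu := congrFun hsu j
    simp only [add_mulVec, smul_mulVec, one_mulVec, Pi.add_apply, Pi.sub_apply,
      mulVec_diagonal] at hj ⊢
    rw [← hj, hl, hu]
    ring
end

section
/- Suppose (Δx, Δs, Δy) satisfies the reduced KKT system (W + δw • 1 + Σx).mulVec Δx + Aᵀ.mulVec Δy = qx, (Σs + δw • 1).mulVec Δs - Δy = qs, A.mulVec Δx - Δs - δc • Δy = qy, where qx := px + (fun i => pzxl i / dxl i) - (fun i => pzxu i / dxu i), qs := ps + (fun j => pzsl j / dsl j) - (fun j => pzsu j / dsu j), qy := py, and define Δzxl := fun i => (-(zxl i) * Δx i + pzxl i) / dxl i, Δzxu := fun i => (zxu i * Δx i + pzxu i) / dxu i, Δzsl := fun j => (-(zsl j) * Δs j + pzsl j) / dsl j, Δzsu := fun j => (zsu j * Δs j + pzsu j) / dsu j. Then (Δx, Δs, Δy, Δzxl, Δzxu, Δzsl, Δzsu) satisfies the full lifted KKT system: (1) (W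 + δw • 1).mulVec Δx + Aᵀ.mulVec Δy - Δzxl + Δzxu = px; (2) δw • Δs - Δy - Δzsl + Δzsu = ps; (3) A.mulVec Δx - Δs - δc • Δy = py; (4) (Matrix.diagonal zxl).mulVec Δx + (Matrix.diagonal dxl).mulVec Δzxl = pzxl; (5) -(Matrix.diagonal zxu).mulVec Δx + (Matrix.diagonal dxu).mulVec Δzxu = pzxu; (6) (Matrix.diagonal zsl).mulVec Δs + (Matrix.diagonal dsl).mulVec Δzsl = pzsl; (7) -(Matrix.diagonal zsu).mulVec Δs + (Matrix.diagonal dsu).mulVec Δzsu = pzsu. -/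
open Matrix

theorem stmt_7 (n m : ℕ) (W : Matrix (Fin n) (Fin n) ℝ) (hW : W.IsSymm)
    (A : Matrix (Fin m) (Fin n) ℝ) (δw δc : ℝ) (hδw : 0 < δw) (hδc : 0 < δc)
    (dxl dxu zxl zxu : Fin n → ℝ)
    (hdxl : ∀ i, 0 < dxl i) (hdxu : ∀ i, 0 < dxu i)
    (hzxl : ∀ i, 0 < zxl i) (hzxu : ∀ i, 0 < zxu i)
    (dsl dsu zsl zsu : Fin m → ℝ)
    (hdsl : ∀ j, 0 < dsl j) (hdsu : ∀ j, 0 < dsu j)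
    (hzsl : ∀ j, 0 < zsl j) (hzsu : ∀ j, 0 < zsu j)
    (px pzxl pzxu : Fin n → ℝ) (ps py pzsl pzsu : Fin m → ℝ)
    (Δx : Fin n → ℝ) (Δs Δy : Fin m → ℝ)
    (hr1 : (W + δw • (1 : Matrix (Fin n) (Fin n) ℝ)
            + Matrix.diagonal (fun i => zxl i / dxl i + zxu i / dxu i)).mulVec Δx
            + Aᵀ.mulVec Δy
          = px + (fun i => pzxl i / dxl i) - (fun i => pzxu i / dxu i))
    (hr2 : (Matrix.diagonal (fun j => zsl j / dsl j + zsu j / dsu j)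
            + δw • (1 : Matrix (Fin m) (Fin m) ℝ)).mulVec Δs - Δy
          = ps + (fun j => pzsl j / dsl j) - (fun j => pzsu j / dsu j))
    (hr3 : A.mulVec Δx - Δs - δc • Δy = py)
    (Δzxl Δzxu : Fin n → ℝ) (Δzsl Δzsu : Fin m → ℝ)
    (hΔzxl : Δzxl = fun i => (-(zxl i) * Δx i + pzxl i) / dxl i)
    (hΔzxu : Δzxu = fun i => (zxu i * Δx i + pzxu i) / dxu i)
    (hΔzsl : Δzsl = fun j => (-(zsl j) * Δs j + pzsl j) / dsl j)
    (hΔzsu : Δzsu = fun j => (zsu j * Δs j + pzsu j) / dsu j) :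
    (W + δw • (1 : Matrix (Fin n) (Fin n) ℝ)).mulVec Δx
        + Aᵀ.mulVec Δy - Δzxl + Δzxu = px ∧
    δw • Δs - Δy - Δzsl + Δzsu = ps ∧
    A.mulVec Δx - Δs - δc • Δy = py ∧
    (Matrix.diagonal zxl).mulVec Δx + (Matrix.diagonal dxl).mulVec Δzxl = pzxl ∧
    -(Matrix.diagonal zxu).mulVec Δx + (Matrix.diagonal dxu).mulVec Δzxu = pzxu ∧
    (Matrix.diagonal zsl).mulVec Δs + (Matrix.diagonal dsl).mulVec Δzsl = pzsl ∧
    -(Matrix.diagonal zsu).mulVec Δs + (Matrix.diagonal dsu).mulVec Δzsu = pzsu := by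
  subst hΔzxl hΔzxu hΔzsl hΔzsu
  refine ⟨?_, ?_, hr3, ?_, ?_, ?_, ?_⟩ <;> ext k
  · have h := congrFun hr1 k
    simp only [add_mulVec, Pi.add_apply, Pi.sub_apply, mulVec_diagonal] at h ⊢
    linear_combination h
  · have h := congrFun hr2 k
    simp only [add_mulVec, smul_mulVec, one_mulVec, Pi.add_apply, Pi.sub_apply,
      mulVec_diagonal] at h ⊢
    linear_combination h
  · simp only [Pi.add_apply, mulVec_diagonal, mul_div_cancel₀ _ (hdxl k).ne']
    ring
  · simp only [Pi.add_apply, Pi.neg_apply, mulVec_diagonal, mul_div_cancel₀ _ (hdxu k).ne']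
    ring
  · simp only [Pi.add_apply, mulVec_diagonal, mul_div_cancel₀ _ (hdsl k).ne']
    ring
  · simp only [Pi.add_apply, Pi.neg_apply, mulVec_diagonal, mul_div_cancel₀ _ (hdsu k).ne']
    ring
end

section
/- If the matrix W + δw • 1 + Σx is positive definite, then for every choice of right-hand sides px, pzxl, pzxu : Fin n → ℝ and ps, py, pzsl, pzsu : Fin m → ℝ, the full lifted KKT system — (1) (W + δw • 1).mulVec Δx + Aᵀ.mulVec Δy - Δzxl + Δzxu = px; (2) δw • Δs - Δy - Δzsl + Δzsu = ps; (3) A.mulVec Δx - Δs - δc • Δy = py; (4) (Matrix.diagonal zxl).mulVec Δx + (Matrix.diagonal dxl).mulVec Δzxl = pzxl; (5) -(Matrix.diagonal zxu).mulVec Δx + (Matrix.diagonal dxu).mulVec Δzxu = pzxu; (6) (Matrix.diagonal zsl).mulVec Δs + (Matrix.diagonal dsl).mulVec Δzsl = pzsl; (7) -(Matrix.diagonal zsu).mulVec Δs + (Matrix.diagonal dsu).mulVec Δzsu = pzsu — has exactly one solution (Δx, Δs, Δy, Δzxl, Δzxu, Δzsl, Δzsu) with Δx, Δzxl, Δzxu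 : Fin n → ℝ and Δs, Δy, Δzsl, Δzsu : Fin m → ℝ. -/
open Matrix

/-- The full lifted KKT system (equations (1)–(7)) as a predicate on the step
direction `(Δx, Δs, Δy, Δzxl, Δzxu, Δzsl, Δzsu)`. -/
def FullKKT (n m : ℕ) (W : Matrix (Fin n) (Fin n) ℝ) (A : Matrix (Fin m) (Fin n) ℝ)
    (δw δc : ℝ) (dxl dxu zxl zxu : Fin n → ℝ) (dsl dsu zsl zsu : Fin m → ℝ)
    (px pzxl pzxu : Fin n → ℝ) (ps py pzsl pzsu : Fin m → ℝ)
    (Δx : Fin n → ℝ) (Δs Δy : Fin m → ℝ) (Δzxl Δzxu : Fin n → ℝ)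
    (Δzsl Δzsu : Fin m → ℝ) : Prop :=
  (W + δw • (1 : Matrix (Fin n) (Fin n) ℝ)).mulVec Δx
      + Aᵀ.mulVec Δy - Δzxl + Δzxu = px ∧
  δw • Δs - Δy - Δzsl + Δzsu = ps ∧
  A.mulVec Δx - Δs - δc • Δy = py ∧
  (Matrix.diagonal zxl).mulVec Δx + (Matrix.diagonal dxl).mulVec Δzxl = pzxl ∧
  -(Matrix.diagonal zxu).mulVec Δx + (Matrix.diagonal dxu).mulVec Δzxu = pzxu ∧
  (Matrix.diagonal zsl).mulVec Δs + (Matrix.diagonal dsl).mulVec Δzsl = pzsl ∧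
  -(Matrix.diagonal zsu).mulVec Δs + (Matrix.diagonal dsu).mulVec Δzsu = pzsu

/-- The left-hand side of the lifted KKT system as an endomorphism of the space of step directions
`(Δx, Δs, Δy, Δzxl, Δzxu, Δzsl, Δzsu)`. -/
def kktMap {n m : ℕ} (W : Matrix (Fin n) (Fin n) ℝ) (A : Matrix (Fin m) (Fin n) ℝ) (δw δc : ℝ)
    (dxl dxu zxl zxu : Fin n → ℝ) (dsl dsu zsl zsu : Fin m → ℝ) :
    Module.End ℝ ((Fin n → ℝ) × (Fin m → ℝ) × (Fin m → ℝ) × (Fin n → ℝ) × (Fin n → ℝ)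
      × (Fin m → ℝ) × (Fin m → ℝ)) where
  toFun := fun (Δx, Δs, Δy, Δzxl, Δzxu, Δzsl, Δzsu) =>
    ((W + δw • (1 : Matrix (Fin n) (Fin n) ℝ)) *ᵥ Δx + Aᵀ *ᵥ Δy - Δzxl + Δzxu,
      δw • Δs - Δy - Δzsl + Δzsu,
      A *ᵥ Δx - Δs - δc • Δy,
      diagonal zxl *ᵥ Δx + diagonal dxl *ᵥ Δzxl,
      -(diagonal zxu *ᵥ Δx) + diagonal dxu *ᵥ Δzxu,
      diagonal zsl *ᵥ Δs + diagonal dsl *ᵥ Δzsl,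
      -(diagonal zsu *ᵥ Δs) + diagonal dsu *ᵥ Δzsu)
  map_add' := by
    rintro ⟨x, s, y, a, b, c, d⟩ ⟨x', s', y', a', b', c', d'⟩
    simp only [Prod.mk_add_mk, mulVec_add, smul_add, Prod.mk.injEq]
    refine ⟨?_, ?_, ?_, ?_, ?_, ?_, ?_⟩ <;> abel
  map_smul' := by
    rintro r ⟨x, s, y, a, b, c, d⟩
    simp only [Prod.smul_mk, mulVec_smul, smul_add, smul_sub, smul_neg, smul_comm r,
      RingHom.id_apply]

theorem kktMap_eq_iff {n m : ℕ} {W : Matrix (Fin n) (Fin n) ℝ} {A : Matrix (Fin m) (Fin n) ℝ}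
    {δw δc : ℝ} {dxl dxu zxl zxu : Fin n → ℝ} {dsl dsu zsl zsu : Fin m → ℝ}
    {px pzxl pzxu : Fin n → ℝ} {ps py pzsl pzsu : Fin m → ℝ}
    {sol : (Fin n → ℝ) × (Fin m → ℝ) × (Fin m → ℝ) × (Fin n → ℝ) × (Fin n → ℝ)
      × (Fin m → ℝ) × (Fin m → ℝ)} :
    kktMap W A δw δc dxl dxu zxl zxu dsl dsu zsl zsu sol = (px, ps, py, pzxl, pzxu, pzsl, pzsu) ↔
      FullKKT n m W A δw δc dxl dxu zxl zxu dsl dsu zsl zsu px pzxl pzxu ps py pzsl pzsu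
        sol.1 sol.2.1 sol.2.2.1 sol.2.2.2.1 sol.2.2.2.2.1
        sol.2.2.2.2.2.1 sol.2.2.2.2.2.2 := by
  simp [kktMap, FullKKT]

theorem eq_neg_div_mul_of_diagonal_mulVec_add_eq_zero {k : ℕ} {z d u v : Fin k → ℝ}
    (hd : ∀ i, 0 < d i) (h : diagonal z *ᵥ u + diagonal d *ᵥ v = 0) (i : Fin k) :
    v i = -(z i / d i * u i) := by
  have hi := congrFun h i
  simp only [Pi.add_apply, mulVec_diagonal, Pi.zero_apply] at hi
  have := (hd i).ne'
  field_simp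
  linarith

theorem eq_div_mul_of_neg_diagonal_mulVec_add_eq_zero {k : ℕ} {z d u v : Fin k → ℝ}
    (hd : ∀ i, 0 < d i) (h : -(diagonal z *ᵥ u) + diagonal d *ᵥ v = 0) (i : Fin k) :
    v i = z i / d i * u i := by
  have := eq_neg_div_mul_of_diagonal_mulVec_add_eq_zero (z := z) (u := -u) (v := v) hd
    (by rwa [mulVec_neg]) i
  simpa using this

/-- The homogeneous condensed system has only the zero solution. -/
theorem condensed_eq_zero {n m : ℕ} {H : Matrix (Fin n) (Fin n) ℝ} (hH : H.PosDef)
    {A : Matrix (Fin m) (Fin n) ℝ} {δ : ℝ} (hδ : 0 < δ) {τ : Fin m → ℝ} (hτ : ∀ j, 0 < τ j)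
    {x : Fin n → ℝ} {s y : Fin m → ℝ} (hx : H *ᵥ x + Aᵀ *ᵥ y = 0) (hy : ∀ j, y j = τ j * s j)
    (hA : A *ᵥ x - s - δ • y = 0) : x = 0 ∧ s = 0 ∧ y = 0 := by
  have hAj (j : Fin m) : (A *ᵥ x) j = s j + δ * y j := by
    have := congrFun hA j
    simp only [Pi.sub_apply, Pi.smul_apply, smul_eq_mul, Pi.zero_apply] at this
    linarith
  have hx0 : x = 0 := by
    by_contra hne
    have hquad : 0 < x ⬝ᵥ H *ᵥ x := by simpa using hH.dotProduct_mulVec_pos hne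
    have hsum : x ⬝ᵥ H *ᵥ x + y ⬝ᵥ A *ᵥ x = 0 := by
      have := congrArg (x ⬝ᵥ ·) hx
      simpa [dotProduct_add, mulVec_transpose, dotProduct_comm x (y ᵥ* A),
        ← dotProduct_mulVec] using this
    have hnonneg : 0 ≤ y ⬝ᵥ A *ᵥ x := by
      refine Finset.sum_nonneg fun j _ => ?_
      have := (hτ j).le
      calc (0 : ℝ) ≤ τ j * s j ^ 2 + δ * y j ^ 2 := by positivity
        _ = y j * (A *ᵥ x) j := by rw [hAj, hy]; ring
    linarith
  have hs0 : s = 0 := by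
    ext j
    have h := hAj j
    rw [hx0, mulVec_zero, hy, Pi.zero_apply] at h
    have hpos : 0 < 1 + δ * τ j := by have := hτ j; positivity
    have : (1 + δ * τ j) * s j = 0 := by linarith
    simpa [hpos.ne'] using this
  exact ⟨hx0, hs0, funext fun j => by simp [hy, hs0]⟩

theorem FullKKT.eq_zero {n m : ℕ} {W : Matrix (Fin n) (Fin n) ℝ} {A : Matrix (Fin m) (Fin n) ℝ}
    {δw δc : ℝ} (hδw : 0 < δw) (hδc : 0 < δc)
    {dxl dxu zxl zxu : Fin n → ℝ} (hdxl : ∀ i, 0 < dxl i) (hdxu : ∀ i, 0 < dxu i)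
    {dsl dsu zsl zsu : Fin m → ℝ} (hdsl : ∀ j, 0 < dsl j) (hdsu : ∀ j, 0 < dsu j)
    (hzsl : ∀ j, 0 < zsl j) (hzsu : ∀ j, 0 < zsu j)
    (hpos : (W + δw • (1 : Matrix (Fin n) (Fin n) ℝ)
        + diagonal (fun i => zxl i / dxl i + zxu i / dxu i)).PosDef)
    {x a b : Fin n → ℝ} {s y c d : Fin m → ℝ}
    (h : FullKKT n m W A δw δc dxl dxu zxl zxu dsl dsu zsl zsu 0 0 0 0 0 0 0 x s y a b c d) :
    x = 0 ∧ s = 0 ∧ y = 0 ∧ a = 0 ∧ b = 0 ∧ c = 0 ∧ d = 0 := by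
  obtain ⟨h₁, h₂, h₃, h₄, h₅, h₆, h₇⟩ := h
  have ha := eq_neg_div_mul_of_diagonal_mulVec_add_eq_zero hdxl h₄
  have hb := eq_div_mul_of_neg_diagonal_mulVec_add_eq_zero hdxu h₅
  have hc := eq_neg_div_mul_of_diagonal_mulVec_add_eq_zero hdsl h₆
  have hd := eq_div_mul_of_neg_diagonal_mulVec_add_eq_zero hdsu h₇
  have hτ (j : Fin m) : 0 < δw + (zsl j / dsl j + zsu j / dsu j) :=
    add_pos hδw (add_pos (div_pos (hzsl j) (hdsl j)) (div_pos (hzsu j) (hdsu j)))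
  obtain ⟨rfl, rfl, rfl⟩ := condensed_eq_zero (x := x) (s := s) (y := y) hpos hδc hτ
    (by
      ext i
      have := congrFun h₁ i
      simp only [Pi.add_apply, Pi.sub_apply, Pi.zero_apply, ha, hb] at this
      rw [add_mulVec _ (diagonal _)]
      simp only [Pi.add_apply, mulVec_diagonal, Pi.zero_apply]
      linarith)
    (fun j => by
      have := congrFun h₂ j
      simp only [Pi.add_apply, Pi.sub_apply, Pi.smul_apply, smul_eq_mul, Pi.zero_apply, hc, hd]
        at this
      linarith)
    h₃
  exact ⟨rfl, rfl, rfl, funext fun i => by simp [ha], funext fun i => by simp [hb],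
    funext fun j => by simp [hc], funext fun j => by simp [hd]⟩

theorem stmt_8 (n m : ℕ) (W : Matrix (Fin n) (Fin n) ℝ) (hW : W.IsSymm)
    (A : Matrix (Fin m) (Fin n) ℝ) (δw δc : ℝ) (hδw : 0 < δw) (hδc : 0 < δc)
    (dxl dxu zxl zxu : Fin n → ℝ)
    (hdxl : ∀ i, 0 < dxl i) (hdxu : ∀ i, 0 < dxu i)
    (hzxl : ∀ i, 0 < zxl i) (hzxu : ∀ i, 0 < zxu i)
    (dsl dsu zsl zsu : Fin m → ℝ)
    (hdsl : ∀ j, 0 < dsl j) (hdsu : ∀ j, 0 < dsu j)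
    (hzsl : ∀ j, 0 < zsl j) (hzsu : ∀ j, 0 < zsu j)
    (hpos : (W + δw • (1 : Matrix (Fin n) (Fin n) ℝ)
        + Matrix.diagonal (fun i => zxl i / dxl i + zxu i / dxu i)).PosDef)
    (px pzxl pzxu : Fin n → ℝ) (ps py pzsl pzsu : Fin m → ℝ) :
    ∃! sol : (Fin n → ℝ) × (Fin m → ℝ) × (Fin m → ℝ) × (Fin n → ℝ) × (Fin n → ℝ)
        × (Fin m → ℝ) × (Fin m → ℝ),
      FullKKT n m W A δw δc dxl dxu zxl zxu dsl dsu zsl zsu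
        px pzxl pzxu ps py pzsl pzsu
        sol.1 sol.2.1 sol.2.2.1 sol.2.2.2.1 sol.2.2.2.2.1
        sol.2.2.2.2.2.1 sol.2.2.2.2.2.2 := by
  have hinj : Function.Injective (kktMap W A δw δc dxl dxu zxl zxu dsl dsu zsl zsu) := by
    refine (injective_iff_map_eq_zero _).2 fun sol h => ?_
    have h0 := (kktMap_eq_iff.1 h).eq_zero hδw hδc hdxl hdxu hdsl hdsu hzsl hzsu hpos
    simpa only [Prod.ext_iff, Prod.fst_zero, Prod.snd_zero] using h0
  simpa only [kktMap_eq_iff] using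
    Function.Bijective.existsUnique ⟨hinj, LinearMap.injective_iff_surjective.1 hinj⟩
      (px, ps, py, pzxl, pzxu, pzsl, pzsu)
end
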